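/- Construction 3: Let q be a prime power, δ, k ≥ 1, m = δ+k, n = (q^m − 1)/(q−1), μ = ⌈δ/k⌉. Let S ∈ F_q^{m × n} be a generator matrix of the q-ary simplex code of dimension m, and let G(z) = ∑_{i=0}^{μ} G_i z^i ∈ F_q[z]^{k×n} be such that G_μ has exactly kμ−δ zero rows and stacking G_0, …, G_{μ−1} and the nonzero rows of G_μ gives S. Then the convolutional code C generated by the rows of G(z) is a non-catastrophic (n,k,δ) convolutional code with column distances d_j^c(C) = (min(j, ⌊δ/k⌋)+1)·q^{m−1} for all j ∈ ℕ0, and free distance d_free(C) = (⌊δ/k⌋+1)·q^{m−1}. -/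

import Mathlib

open Finset Polynomial Matrix

noncomputable section

variable {F : Type*} [Field F] [DecidableEq F]

/-- The coefficient vector at time `t` of a polynomial vector `v(z)`. -/
def coeffVec {ι : Type*} (v : ι → Polynomial F) (t : ℕ) : ι → F := fun i => (v i).coeff t

/-- `G(z)` is a generator matrix of the convolutional code `C`:
its rows form a basis of `C`. -/
def IsGenMat {ι : Type*} {k : ℕ} (C : Submodule (Polynomial F) (ι → Polynomial F))
    (G : Matrix (Fin k) ι (Polynomial F)) : Prop :=
  LinearIndependent (Polynomial F) (fun i => G i) ∧
    Submodule.span (Polynomial F) (Set.range fun i => G i) = C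

/-- The `j`-th column distance of a convolutional code. -/
def colDist {ι : Type*} [Fintype ι] (C : Submodule (Polynomial F) (ι → Polynomial F))
    (j : ℕ) : ℕ :=
  sInf { d : ℕ | ∃ v ∈ C, coeffVec v 0 ≠ 0 ∧
      d = ∑ t ∈ Finset.range (j + 1), hammingNorm (coeffVec v t) }

/-- The free distance of a convolutional code. -/
def freeDist {ι : Type*} [Fintype ι] (C : Submodule (Polynomial F) (ι → Polynomial F)) : ℕ :=
  sInf { d : ℕ | ∃ v ∈ C, v ≠ 0 ∧ d = ∑ᶠ t : ℕ, hammingNorm (coeffVec v t) }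

/-- External degree of a polynomial matrix: the sum of its row degrees. -/
def extDeg {ι : Type*} [Fintype ι] {k : ℕ} (G : Matrix (Fin k) ι (Polynomial F)) : ℕ :=
  ∑ i : Fin k, Finset.univ.sup fun j : ι => (G i j).natDegree

/-- Internal degree of a polynomial matrix: the maximal degree of its `k×k` minors. -/
def intDeg {ι : Type*} [Fintype ι] [DecidableEq ι] {k : ℕ}
    (G : Matrix (Fin k) ι (Polynomial F)) : ℕ :=
  Finset.univ.sup fun f : Fin k ↪ ι => ((G.submatrix id fun i => f i).det).natDegree

/-- `C` is an `(n,k,δ)` convolutional code: it has a row-reduced generator matrix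
(with `k` rows, internal degree = external degree) of external degree `δ`. -/
def HasParams {ι : Type*} [Fintype ι] [DecidableEq ι] (k δ : ℕ)
    (C : Submodule (Polynomial F) (ι → Polynomial F)) : Prop :=
  ∃ G : Matrix (Fin k) ι (Polynomial F), IsGenMat C G ∧ intDeg G = extDeg G ∧ extDeg G = δ

/-- `C` is delay-free: some generator matrix `G(z)` has `G(0)` of full row rank `k`. -/
def IsDelayFree {ι : Type*} [Fintype ι] (k : ℕ)
    (C : Submodule (Polynomial F) (ι → Polynomial F)) : Prop :=
  ∃ G : Matrix (Fin k) ι (Polynomial F), IsGenMat C G ∧ (G.map fun p => p.coeff 0).rank = k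

/-- `C` is non-catastrophic: it admits a full-rank parity-check matrix. -/
def IsNoncatastrophic {ι : Type*} [Fintype ι] (k : ℕ)
    (C : Submodule (Polynomial F) (ι → Polynomial F)) : Prop :=
  ∃ H : Matrix (Fin (Fintype.card ι - k)) ι (Polynomial F),
    LinearIndependent (Polynomial F) (fun i => H i) ∧ ∀ v, v ∈ C ↔ H.mulVec v = 0

/-- `rowPad S t` is row `t` of the matrix `S` if `t < m`, and the zero row otherwise. -/
def rowPad {m : ℕ} {ι : Type*} (S : Matrix (Fin m) ι F) (t : ℕ) : ι → F :=
  if h : t < m then S ⟨t, h⟩ else 0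

/-- By counting, the columns of a simplex generator matrix represent every nonzero vector up to
a nonzero scalar. -/
lemma simplex_bijective {F : Type*} [Field F] [Fintype F] [DecidableEq F] {m N : ℕ}
    (hN : N * (Fintype.card F - 1) = Fintype.card F ^ m - 1)
    (S : Matrix (Fin m) (Fin N) F)
    (hS1 : ∀ j, (fun i => S i j) ≠ 0)
    (hS2 : ∀ j j', j ≠ j' → ∀ c : F, (fun i => S i j') ≠ c • fun i => S i j) :
    Function.Bijective (fun x : Fˣ × Fin N =>
      (⟨(x.1 : F) • fun i => S i x.2, smul_ne_zero x.1.ne_zero (hS1 x.2)⟩ :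
        {w : Fin m → F // w ≠ 0})) := by
  classical
  rw [Fintype.bijective_iff_injective_and_card]
  constructor
  · rintro ⟨a, j⟩ ⟨b, j'⟩ h
    have h : (a : F) • (fun i => S i j) = (b : F) • fun i => S i j' := congrArg Subtype.val h
    by_cases hj : j = j'
    · subst hj
      have := smul_left_injective F (hS1 j) h
      rw [Units.ext this]
    · refine absurd ?_ (hS2 j j' hj ((b : F)⁻¹ * a))
      rw [mul_smul, h, smul_smul, inv_mul_cancel₀ b.ne_zero, one_smul]
  · rw [Fintype.card_prod, Fintype.card_units, Fintype.card_fin, mul_comm, hN,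
      Fintype.card_subtype_compl, Fintype.card_subtype_eq, Fintype.card_fun, Fintype.card_fin]

/-- Every unit vector is, up to a nonzero scalar, a column of a simplex generator matrix. -/
lemma simplex_exists_col_single {F : Type*} [Field F] [Fintype F] [DecidableEq F] {m N : ℕ}
    (hN : N * (Fintype.card F - 1) = Fintype.card F ^ m - 1)
    (S : Matrix (Fin m) (Fin N) F)
    (hS1 : ∀ j, (fun i => S i j) ≠ 0)
    (hS2 : ∀ j j', j ≠ j' → ∀ c : F, (fun i => S i j') ≠ c • fun i => S i j) (p : Fin m) :
    ∃ (j : Fin N) (a : F), a ≠ 0 ∧ ∀ i, S i j = if i = p then a else 0 := by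
  obtain ⟨⟨a, j⟩, h⟩ := (simplex_bijective hN S hS1 hS2).2 ⟨Pi.single p 1, by simp⟩
  have h : (a : F) • (fun i => S i j) = Pi.single p 1 := congrArg Subtype.val h
  refine ⟨j, (a : F)⁻¹, inv_ne_zero a.ne_zero, fun i => ?_⟩
  have hi := congrFun h i
  simp only [Pi.smul_apply, smul_eq_mul, Pi.single_apply] at hi
  rw [← mul_right_inj' a.ne_zero, hi]
  split_ifs <;> simp

/-- Every nonzero linear form vanishes on exactly `q ^ (m - 1)` vectors. -/
lemma card_dotProduct_eq_zero {F : Type*} [Field F] [Fintype F] [DecidableEq F] {m : ℕ}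
    (x : Fin m → F) (hx : x ≠ 0) :
    Fintype.card {w : Fin m → F // x ⬝ᵥ w = 0} = Fintype.card F ^ (m - 1) := by
  classical
  let f : Module.Dual F (Fin m → F) := dotProductBilin F F x
  have hf : f ≠ 0 := by
    intro h
    apply hx
    funext i
    simpa [f] using LinearMap.congr_fun h (Pi.single i 1)
  have h1 := Module.Dual.finrank_ker_add_one_of_ne_zero hf
  rw [Module.finrank_fin_fun] at h1
  have h2 := Module.card_eq_pow_finrank (K := F) (V := LinearMap.ker f)
  rw [show m - 1 = Module.finrank F (LinearMap.ker f) by omega, ← h2]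
  exact Fintype.card_congr (Equiv.subtypeEquivRight fun w => by simp [f])

/-- All nonzero words of the simplex code have weight `q ^ (m - 1)`. -/
lemma hammingNorm_simplex {F : Type*} [Field F] [Fintype F] [DecidableEq F] {m N : ℕ}
    (hm : 1 ≤ m)
    (hN : N * (Fintype.card F - 1) = Fintype.card F ^ m - 1)
    (S : Matrix (Fin m) (Fin N) F)
    (hS1 : ∀ j, (fun i => S i j) ≠ 0)
    (hS2 : ∀ j j', j ≠ j' → ∀ c : F, (fun i => S i j') ≠ c • fun i => S i j)
    (x : Fin m → F) (hx : x ≠ 0) :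
    hammingNorm (x ᵥ* S) = Fintype.card F ^ (m - 1) := by
  classical
  let E := Equiv.ofBijective _ (simplex_bijective hN S hS1 hS2)
  have h1 : Fintype.card {y : Fˣ × Fin N // (x ᵥ* S) y.2 ≠ 0}
      = Fintype.card {w : {w : Fin m → F // w ≠ 0} // x ⬝ᵥ w.1 ≠ 0} := by
    refine Fintype.card_congr (E.subtypeEquiv fun y => ?_)
    have : x ⬝ᵥ (E y).1 = (y.1 : F) * (x ᵥ* S) y.2 := by
      change x ⬝ᵥ ((y.1 : F) • fun i => S i y.2) = _
      rw [dotProduct_smul]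
      rfl
    rw [this]
    simp
  have h2 : Fintype.card {y : Fˣ × Fin N // (x ᵥ* S) y.2 ≠ 0}
      = (Fintype.card F - 1) * hammingNorm (x ᵥ* S) := by
    rw [Fintype.card_subtype, ← Fintype.card_units, hammingNorm, ← Finset.card_univ,
      ← Finset.card_product]
    congr 1
    ext y
    simp
  have h3 : Fintype.card {w : {w : Fin m → F // w ≠ 0} // x ⬝ᵥ w.1 ≠ 0}
      = Fintype.card F ^ m - Fintype.card F ^ (m - 1) := by
    rw [← card_dotProduct_eq_zero x hx]
    have : Fintype.card F ^ m = Fintype.card (Fin m → F) := by simp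
    rw [this, ← Fintype.card_subtype_compl]
    refine Fintype.card_congr (Equiv.subtypeSubtypeEquivSubtype (p := fun w => w ≠ 0)
      (q := fun w => ¬ x ⬝ᵥ w = 0) fun {w} hw h0 => hw ?_)
    rw [h0, dotProduct_zero]
  obtain ⟨l, rfl⟩ : ∃ l, m = l + 1 := ⟨m - 1, by omega⟩
  have hq : 1 < Fintype.card F := Fintype.one_lt_card
  apply Nat.eq_of_mul_eq_mul_left (Nat.sub_pos_of_lt hq)
  rw [← h2, h1, h3, Nat.sub_mul, Nat.add_sub_cancel, pow_succ, one_mul, mul_comm]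

/-- A polynomial matrix with a polynomial right inverse has linearly independent rows. -/
lemma linearIndependent_rows_of_mul_eq_one {R κ ι : Type*} [CommRing R] [Fintype κ]
    [DecidableEq κ] [Fintype ι] (G : Matrix κ ι R) (B : Matrix ι κ R) (h : G * B = 1) :
    LinearIndependent R (fun r => G r) := by
  rw [← Matrix.row_def, ← Matrix.vecMul_injective_iff]
  intro x y hxy
  have := congrArg (· ᵥ* B) hxy
  simpa [Matrix.vecMul_vecMul, h] using this

/-- A code whose generator matrix has a polynomial right inverse is non-catastrophic. -/
lemma isNoncatastrophic_of_mul_eq_one {F : Type*} [Field F] {k N : ℕ}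
    (G : Matrix (Fin k) (Fin N) F[X]) (B : Matrix (Fin N) (Fin k) F[X]) (h : G * B = 1) :
    IsNoncatastrophic k (Submodule.span F[X] (Set.range fun r => G r)) := by
  set C := Submodule.span F[X] (Set.range fun r => G r) with hC
  have hCmem : ∀ v, v ∈ C ↔ ∃ u, u ᵥ* G = v := by
    intro v
    rw [hC, Submodule.mem_span_range_iff_exists_fun]
    simp only [Matrix.vecMul_eq_sum]
  -- the kernel of the projection `v ↦ v - (v B) G` is `C`
  let π : (Fin N → F[X]) →ₗ[F[X]] (Fin N → F[X]) :=
    LinearMap.id - G.vecMulLinear ∘ₗ B.vecMulLinear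
  have hπ : ∀ v, π v = v - (v ᵥ* B) ᵥ* G := fun v => rfl
  have hker : LinearMap.ker π = C := by
    ext v
    rw [LinearMap.mem_ker, hπ, sub_eq_zero, hCmem]
    constructor
    · intro hv
      exact ⟨_, hv.symm⟩
    · rintro ⟨u, rfl⟩
      rw [Matrix.vecMul_vecMul u, h, Matrix.vecMul_one]
  have hrank : Module.finrank F[X] (LinearMap.range π) = Fintype.card (Fin N) - k := by
    have h1 := (LinearMap.ker π).finrank_quotient_add_finrank
    rw [π.quotKerEquivRange.finrank_eq] at h1
    have h2 : Module.finrank F[X] C = k := by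
      rw [hC, finrank_span_eq_card (linearIndependent_rows_of_mul_eq_one G B h),
        Fintype.card_fin]
    rw [hker, h2, Module.finrank_fin_fun] at h1
    rw [Fintype.card_fin]
    omega
  let b := Module.finBasisOfFinrankEq F[X] (LinearMap.range π) hrank
  let f : (Fin N → F[X]) →ₗ[F[X]] (Fin (Fintype.card (Fin N) - k) → F[X]) :=
    b.equivFun.toLinearMap ∘ₗ π.rangeRestrict
  have hf : Function.Surjective f :=
    b.equivFun.surjective.comp π.surjective_rangeRestrict
  obtain ⟨g, hg⟩ := Module.projective_lifting_property f LinearMap.id hf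
  refine ⟨LinearMap.toMatrix' f, ?_, fun v => ?_⟩
  · refine linearIndependent_rows_of_mul_eq_one _ (LinearMap.toMatrix' g) ?_
    rw [← LinearMap.toMatrix'_comp, hg, LinearMap.toMatrix'_id]
  · rw [LinearMap.toMatrix'_mulVec, ← hker, LinearMap.mem_ker]
    change _ ↔ b.equivFun (π.rangeRestrict v) = 0
    rw [LinearEquiv.map_eq_zero_iff, ← LinearMap.codRestrict_apply, Subtype.ext_iff]
    rfl

/-- The degree of a determinant is at most the sum of row degree bounds. -/
lemma natDegree_det_le_sum {R κ : Type*} [CommRing R] [Fintype κ] [DecidableEq κ]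
    (M : Matrix κ κ R[X]) (D : κ → ℕ) (h : ∀ i j, (M i j).natDegree ≤ D i) :
    M.det.natDegree ≤ ∑ i, D i := by
  rw [← Matrix.det_transpose, Matrix.det_apply]
  refine Polynomial.natDegree_sum_le_of_forall_le _ _ fun σ _ => ?_
  refine (Polynomial.natDegree_smul_le _ _).trans ?_
  exact (Polynomial.natDegree_prod_le _ _).trans (Finset.sum_le_sum fun i _ => h i _)

/-- The row `p` of `S` enters `G(z)` in row `ρ p` with delay `d p`. -/
def delayMat {F : Type*} [Field F] {m k N : ℕ} (S : Matrix (Fin m) (Fin N) F)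
    (d : Fin m → ℕ) (ρ : Fin m → Fin k) : Matrix (Fin k) (Fin N) F[X] :=
  fun r c => ∑ p, if ρ p = r then X ^ d p * Polynomial.C (S p c) else 0

lemma coeffVec_vecMul_delayMat {F : Type*} [Field F] {m k N : ℕ}
    (S : Matrix (Fin m) (Fin N) F) (d : Fin m → ℕ) (ρ : Fin m → Fin k)
    (u : Fin k → F[X]) (t : ℕ) :
    coeffVec (u ᵥ* delayMat S d ρ) t = (fun p => (u (ρ p) * X ^ d p).coeff t) ᵥ* S := by
  funext c
  simp only [coeffVec, Matrix.vecMul, dotProduct, delayMat, Finset.mul_sum, mul_ite, mul_zero]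
  rw [Finset.sum_comm]
  simp only [Finset.sum_ite_eq, Finset.mem_univ, if_true, Polynomial.finsetSum_coeff,
    ← mul_assoc, Polynomial.coeff_mul_C]

lemma delayMat_apply_single {F : Type*} [Field F] {m k N : ℕ}
    (S : Matrix (Fin m) (Fin N) F) (d : Fin m → ℕ) (ρ : Fin m → Fin k)
    (p : Fin m) (c : Fin N) (a : F) (h : ∀ i, S i c = if i = p then a else 0) (r : Fin k) :
    delayMat S d ρ r c = if ρ p = r then X ^ d p * Polynomial.C a else 0 := by
  rw [delayMat, Finset.sum_eq_single p]
  · simp [h]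
  · intro i _ hi
    simp [h, hi]
  · simp

lemma natDegree_delayMat_le {F : Type*} [Field F] {m k N : ℕ}
    (S : Matrix (Fin m) (Fin N) F) (d : Fin m → ℕ) (ρ : Fin m → Fin k) (r : Fin k) (D : ℕ)
    (hD : ∀ p, ρ p = r → d p ≤ D) (c : Fin N) : (delayMat S d ρ r c).natDegree ≤ D := by
  refine Polynomial.natDegree_sum_le_of_forall_le _ _ fun p _ => ?_
  split_ifs with h
  · rw [mul_comm]
    exact (Polynomial.natDegree_C_mul_X_pow_le _ _).trans (hD p h)
  · simp

/-- If the columns of `S` contain multiples of all unit vectors, then `delayMat S d ρ` is row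
reduced, with row degrees the maximal delays. -/
lemma intDeg_delayMat {F : Type*} [Field F] {m k N : ℕ}
    (S : Matrix (Fin m) (Fin N) F) (d : Fin m → ℕ) (ρ : Fin m → Fin k)
    (hS : ∀ p, ∃ (j : Fin N) (a : F), a ≠ 0 ∧ ∀ i, S i j = if i = p then a else 0)
    (D : Fin k → ℕ) (hD : ∀ p, d p ≤ D (ρ p)) (hD' : ∀ r, ∃ p, ρ p = r ∧ d p = D r) :
    intDeg (delayMat S d ρ) = ∑ r, D r ∧ extDeg (delayMat S d ρ) = ∑ r, D r := by
  have hdeg : ∀ r c, (delayMat S d ρ r c).natDegree ≤ D r := fun r c =>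
    natDegree_delayMat_le S d ρ r _ (by rintro p rfl; exact hD p) c
  choose col a ha hcol using hS
  choose top hρ hd using hD'
  have hentry : ∀ r r', delayMat S d ρ r (col (top r'))
      = if r' = r then X ^ D r' * Polynomial.C (a (top r')) else 0 := by
    intro r r'
    rw [delayMat_apply_single S d ρ _ _ _ (hcol (top r')), hρ, hd]
  constructor
  · apply le_antisymm
    · exact Finset.sup_le fun f _ => natDegree_det_le_sum _ D fun i j => hdeg i _
    · have hinj : Function.Injective fun r => col (top r) := by
        intro r r' h
        have h1 := hcol (top r) (top r)
        have h2 := hcol (top r') (top r)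
        simp only at h
        rw [h, h2] at h1
        by_contra hne
        have : top r ≠ top r' := fun h => hne (by rw [← hρ r, h, hρ])
        simp [this, (ha (top r)).symm] at h1
      refine le_trans (le_of_eq ?_) (Finset.le_sup (Finset.mem_univ ⟨_, hinj⟩))
      have : (delayMat S d ρ).submatrix id (fun i => col (top i))
          = Matrix.diagonal fun r => X ^ D r * Polynomial.C (a (top r)) := by
        ext1 r r'
        rw [Matrix.submatrix_apply, id, hentry, Matrix.diagonal_apply]
        by_cases h : r = r'
        · simp [h]
        · simp [h, Ne.symm h]
      simp only [Function.Embedding.coeFn_mk]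
      rw [this, Matrix.det_diagonal, Polynomial.natDegree_prod]
      · refine Finset.sum_congr rfl fun r _ => ?_
        rw [Polynomial.natDegree_mul_C (ha _), Polynomial.natDegree_X_pow]
      · intro r _
        simp [ha]
  · refine Finset.sum_congr rfl fun r _ => le_antisymm ?_ ?_
    · exact Finset.sup_le fun c _ => hdeg r c
    · refine le_trans (le_of_eq ?_) (Finset.le_sup (Finset.mem_univ (col (top r))))
      rw [hentry, if_pos rfl, Polynomial.natDegree_mul_C (ha _), Polynomial.natDegree_X_pow]

/-- If every row has an undelayed contribution and the columns of `S` contain multiples of all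
unit vectors, then `delayMat S d ρ` is right invertible. -/
lemma exists_delayMat_mul_eq_one {F : Type*} [Field F] {m k N : ℕ}
    (S : Matrix (Fin m) (Fin N) F) (d : Fin m → ℕ) (ρ : Fin m → Fin k)
    (hS : ∀ p, ∃ (j : Fin N) (a : F), a ≠ 0 ∧ ∀ i, S i j = if i = p then a else 0)
    (h0 : ∀ r, ∃ p, ρ p = r ∧ d p = 0) : ∃ B : Matrix (Fin N) (Fin k) F[X], delayMat S d ρ * B = 1 := by
  choose col a ha hcol using hS
  choose p hρ hd using h0
  refine ⟨Matrix.of fun c r => if c = col (p r) then Polynomial.C (a (p r))⁻¹ else 0, ?_⟩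
  ext1 r r'
  rw [Matrix.mul_apply, Finset.sum_eq_single (col (p r'))]
  · rw [delayMat_apply_single S d ρ _ _ _ (hcol (p r')), hρ, hd, Matrix.one_apply]
    by_cases h : r = r'
    · simp [h, ← Polynomial.C_mul, ha]
    · simp [h, Ne.symm h]
  · intro c _ hc
    simp [hc]
  · simp

lemma hammingNorm_finite_support {F : Type*} [Field F] [DecidableEq F] {N : ℕ}
    (v : Fin N → F[X]) : (Function.support fun t => hammingNorm (coeffVec v t)).Finite := by
  refine (Finset.finite_toSet
    (Finset.range (Finset.univ.sup (fun i => (v i).natDegree) + 1))).subset ?_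
  intro t ht
  by_contra hlt
  apply ht
  simp only [Finset.coe_range, Set.mem_Iio, not_lt] at hlt
  simp only [hammingNorm_eq_zero]
  funext i
  refine Polynomial.coeff_eq_zero_of_natDegree_lt (lt_of_le_of_lt ?_ hlt)
  exact Finset.le_sup (f := fun i => (v i).natDegree) (Finset.mem_univ i)

/-- Column and free distances of the code generated by `delayMat S d ρ` when `S` is a generator
matrix of a constant weight code, every row is used with all delays up to `ν`, and some row with
no other delays. -/
lemma distances_delayMat {F : Type*} [Field F] [DecidableEq F] {m k N ν w : ℕ}
    (S : Matrix (Fin m) (Fin N) F) (d : Fin m → ℕ) (ρ : Fin m → Fin k)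
    (hw : ∀ x : Fin m → F, x ≠ 0 → hammingNorm (x ᵥ* S) = w) (hw0 : 0 < w)
    (hfull : ∀ i ≤ ν, ∀ r, ∃ p, ρ p = r ∧ d p = i)
    (hshort : ∃ r, ∀ p, ρ p = r → d p ≤ ν) :
    (∀ j, colDist (Submodule.span F[X] (Set.range fun r => delayMat S d ρ r)) j
      = (min j ν + 1) * w) ∧
    freeDist (Submodule.span F[X] (Set.range fun r => delayMat S d ρ r)) = (ν + 1) * w := by
  have hCmem : ∀ v, v ∈ Submodule.span F[X] (Set.range fun r => delayMat S d ρ r) ↔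
      ∃ u, u ᵥ* delayMat S d ρ = v := by
    intro v
    rw [Submodule.mem_span_range_iff_exists_fun]
    simp only [Matrix.vecMul_eq_sum]
  have hweight : ∀ (u : Fin k → F[X]) (r : Fin k) (s t : ℕ), (u r).coeff s ≠ 0 → t ≤ ν →
      hammingNorm (coeffVec (u ᵥ* delayMat S d ρ) (s + t)) = w := by
    intro u r s t hu ht
    rw [coeffVec_vecMul_delayMat]
    refine hw _ fun h => hu ?_
    obtain ⟨p, hp, hd⟩ := hfull t ht r
    have := congrFun h p
    simpa [hp, hd, Polynomial.coeff_mul_X_pow] using this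
  obtain ⟨r₀, hr₀⟩ := hshort
  let u₀ : Fin k → F[X] := Pi.single r₀ 1
  have hu₀ : (u₀ r₀).coeff 0 ≠ 0 := by simp [u₀]
  let v₀ := u₀ ᵥ* delayMat S d ρ
  have hlow : ∀ t ≤ ν, hammingNorm (coeffVec v₀ t) = w := by
    intro t ht
    simpa using hweight u₀ r₀ 0 t hu₀ ht
  have hhigh : ∀ t, ν < t → hammingNorm (coeffVec v₀ t) = 0 := by
    intro t ht
    rw [hammingNorm_eq_zero, coeffVec_vecMul_delayMat]
    convert Matrix.zero_vecMul S
    rename_i p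
    by_cases hp : ρ p = r₀
    · have : t ≠ d p := by have := hr₀ p hp; omega
      simp [u₀, hp, Polynomial.coeff_X_pow, this]
    · simp [u₀, hp]
  have hv₀ : coeffVec v₀ 0 ≠ 0 := by
    rw [← hammingNorm_ne_zero_iff, hlow 0 (Nat.zero_le _)]
    exact hw0.ne'
  constructor
  · intro j
    apply le_antisymm
    · refine Nat.sInf_le ⟨v₀, (hCmem _).2 ⟨u₀, rfl⟩, hv₀, ?_⟩
      rw [← Finset.sum_subset (s₁ := Finset.range (min j ν + 1))]
      · rw [Finset.sum_congr rfl (g := fun _ => w)]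
        · simp
        · intro t ht
          rw [Finset.mem_range] at ht
          exact hlow t (by omega)
      · intro t
        simp only [Finset.mem_range]
        omega
      · intro t ht ht'
        simp only [Finset.mem_range] at ht ht'
        exact hhigh t (by omega)
    · refine le_csInf ⟨_, v₀, (hCmem _).2 ⟨u₀, rfl⟩, hv₀, rfl⟩ ?_
      rintro _ ⟨v, hv, hv0, rfl⟩
      obtain ⟨u, rfl⟩ := (hCmem v).1 hv
      obtain ⟨r, hr⟩ : ∃ r, (u r).coeff 0 ≠ 0 := by
        by_contra! hu
        apply hv0
        rw [coeffVec_vecMul_delayMat]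
        convert Matrix.zero_vecMul S
        simp [Polynomial.mul_coeff_zero, hu]
      have : (min j ν + 1) * w = ∑ t ∈ Finset.range (min j ν + 1),
          hammingNorm (coeffVec (u ᵥ* delayMat S d ρ) t) := by
        rw [Finset.sum_congr rfl (g := fun _ => w)]
        · simp
        · intro t ht
          rw [Finset.mem_range] at ht
          simpa using hweight u r 0 t hr (by omega)
      rw [this]
      exact Finset.sum_le_sum_of_subset (Finset.range_subset_range.2 (by omega))
  · apply le_antisymm
    · refine Nat.sInf_le ⟨v₀, (hCmem _).2 ⟨u₀, rfl⟩, fun h => hv₀ ?_, ?_⟩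
      · rw [h]
        rfl
      · rw [finsum_eq_sum_of_support_subset (s := Finset.range (ν + 1))]
        · rw [Finset.sum_congr rfl (g := fun _ => w)]
          · simp
          · intro t ht
            rw [Finset.mem_range] at ht
            exact hlow t (by omega)
        · intro t ht
          by_contra hlt
          simp only [Finset.coe_range, Set.mem_Iio, not_lt] at hlt
          exact ht (hhigh t hlt)
    · refine le_csInf ⟨_, v₀, (hCmem _).2 ⟨u₀, rfl⟩, fun h => hv₀ (by rw [h]; rfl), rfl⟩ ?_
      rintro _ ⟨v, hv, hv0, rfl⟩
      obtain ⟨u, rfl⟩ := (hCmem v).1 hv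
      obtain ⟨r, s, hr⟩ : ∃ r s, (u r).coeff s ≠ 0 := by
        by_contra! hu
        apply hv0
        have : u = 0 := funext fun r => Polynomial.ext (hu r)
        rw [this, Matrix.zero_vecMul]
      have : (ν + 1) * w = ∑ t ∈ (Finset.range (ν + 1)).map (addLeftEmbedding s),
          hammingNorm (coeffVec (u ᵥ* delayMat S d ρ) t) := by
        rw [Finset.sum_map, Finset.sum_congr rfl (g := fun _ => w)]
        · simp
        · intro t ht
          rw [Finset.mem_range] at ht
          exact hweight u r s t hr (by omega)
      have hfin := hammingNorm_finite_support (u ᵥ* delayMat S d ρ)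
      rw [this, finsum_eq_sum_of_support_subset
        (s := hfin.toFinset ∪ (Finset.range (ν + 1)).map (addLeftEmbedding s))]
      · exact Finset.sum_le_sum_of_subset Finset.subset_union_right
      · intro t ht
        simp only [Finset.coe_union, Set.Finite.coe_toFinset]
        exact Or.inl ht

/-- **Construction 3.** The `((q^{δ+k}−1)/(q−1), k, δ)` convolutional code whose stacked
coefficient matrix is a generator matrix of the `q`-ary simplex code of dimension `δ+k`
is non-catastrophic, has column distances `d_j^c = (min(j,⌊δ/k⌋)+1)·q^{δ+k−1}` and free
distance `(⌊δ/k⌋+1)·q^{δ+k−1}`. -/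
theorem stmt_16 {F : Type*} [Field F] [Fintype F] [DecidableEq F]
    (q k δ N μ : ℕ) (hq : Fintype.card F = q)
    (hk : 1 ≤ k) (hδ : 1 ≤ δ)
    (hN : N * (q - 1) = q ^ (δ + k) - 1)
    (hμ : μ = (δ + k - 1) / k)
    (S : Matrix (Fin (δ + k)) (Fin N) F)
    (hS1 : ∀ j, (fun i => S i j) ≠ 0)
    (hS2 : ∀ j j', j ≠ j' → ∀ c : F, (fun i => S i j') ≠ c • fun i => S i j)
    (Gc : ℕ → Matrix (Fin k) (Fin N) F)
    (e : Fin (δ + k - k * μ) → Fin k) (he : StrictMono e)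
    (hstack : ∀ i, i < μ → ∀ r : Fin k, Gc i r = rowPad S (i * k + r.val))
    (hlast : ∀ s : Fin (δ + k - k * μ), Gc μ (e s) = rowPad S (μ * k + s.val))
    (hzero : ∀ r : Fin k, r ∉ Set.range e → Gc μ r = 0)
    (G : Matrix (Fin k) (Fin N) (Polynomial F))
    (hG : ∀ r c, G r c = ∑ i ∈ Finset.range (μ + 1), Polynomial.C (Gc i r c) * Polynomial.X ^ i) :
    LinearIndependent (Polynomial F) (fun r => G r) ∧
    IsNoncatastrophic k (Submodule.span (Polynomial F) (Set.range fun r => G r)) ∧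
    HasParams k δ (Submodule.span (Polynomial F) (Set.range fun r => G r)) ∧
    (∀ j : ℕ, colDist (Submodule.span (Polynomial F) (Set.range fun r => G r)) j
        = (min j (δ / k) + 1) * q ^ (δ + k - 1)) ∧
    freeDist (Submodule.span (Polynomial F) (Set.range fun r => G r))
        = (δ / k + 1) * q ^ (δ + k - 1) := by
  subst hq
  have hk0 : 0 < k := hk
  have hμ1 : μ * k < δ + k := by
    have := Nat.div_mul_le_self (δ + k - 1) k
    rw [← hμ] at this
    omega
  have hμ2 : δ ≤ μ * k := by
    have := Nat.lt_div_mul_add (a := δ + k - 1) hk0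
    rw [← hμ] at this
    omega
  have hμ0 : 0 < μ := by
    rcases Nat.eq_zero_or_pos μ with h | h
    · rw [h, zero_mul] at hμ2
      omega
    · exact h
  have hcomm : k * μ = μ * k := mul_comm _ _
  have hsucc : (μ - 1) * k + k = μ * k := by
    rw [← Nat.succ_mul, Nat.succ_eq_add_one, Nat.sub_add_cancel hμ0]
  let d : Fin (δ + k) → ℕ := fun p => p.val / k
  let ρ : Fin (δ + k) → Fin k := fun p =>
    if p.val < μ * k then ⟨p.val % k, Nat.mod_lt _ hk0⟩
    else e ⟨p.val - k * μ, by omega⟩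
  have hdlast : ∀ p : Fin (δ + k), ¬ p.val < μ * k → d p = μ := by
    intro p hp
    refine Nat.div_eq_of_lt_le (by omega) ?_
    rw [Nat.add_mul]
    omega
  have hdlt : ∀ p : Fin (δ + k), p.val < μ * k → d p < μ := fun p hp =>
    (Nat.div_lt_iff_lt_mul hk0).2 hp
  have hdle : ∀ p, d p ≤ μ := fun p => by
    by_cases hp : p.val < μ * k
    · exact (hdlt p hp).le
    · exact (hdlast p hp).le
  -- the row of `S` used in row `r` with delay `i`
  have hearly : ∀ i < μ, ∀ r : Fin k, i * k + r.val < μ * k := by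
    intro i hi r
    have := Nat.mul_le_mul_right k (Nat.le_sub_one_of_lt hi)
    omega
  have hpos : ∀ i < μ, ∀ (r : Fin k) (p : Fin (δ + k)),
      (ρ p = r ∧ d p = i) ↔ p.val = i * k + r.val := by
    intro i hi r p
    constructor
    · rintro ⟨rfl, rfl⟩
      by_cases hp : p.val < μ * k
      · simp only [ρ, d, if_pos hp]
        rw [mul_comm, Nat.div_add_mod]
      · exact absurd (hdlast p hp) hi.ne
    · intro h
      have hp : p.val < μ * k := h ▸ hearly i hi r
      simp only [ρ, d, if_pos hp]
      rw [h]
      refine ⟨Fin.ext ?_, ?_⟩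
      · simp [Nat.mul_add_mod_self_right, Nat.mod_eq_of_lt r.isLt]
      · rw [mul_comm, Nat.mul_add_div hk0, Nat.div_eq_of_lt r.isLt, add_zero]
  have hposlast : ∀ (s : Fin (δ + k - k * μ)) (p : Fin (δ + k)),
      (ρ p = e s ∧ d p = μ) ↔ p.val = μ * k + s.val := by
    intro s p
    by_cases hp : p.val < μ * k
    · have := hdlt p hp
      constructor
      · rintro ⟨-, h⟩
        omega
      · omega
    · simp only [ρ, if_neg hp, hdlast p hp, and_true]
      rw [he.injective.eq_iff, Fin.ext_iff]
      simp only
      omega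
  have hGc : ∀ i ≤ μ, ∀ r c,
      Gc i r c = ∑ p, if ρ p = r ∧ d p = i then S p c else 0 := by
    intro i hi r c
    rcases hi.lt_or_eq with hi | rfl
    · have hlt : i * k + r.val < δ + k := (hearly i hi r).trans hμ1
      rw [hstack i hi, rowPad, dif_pos hlt]
      simp only [hpos i hi r]
      rw [Finset.sum_eq_single ⟨i * k + r.val, hlt⟩]
      · simp
      · intro p _ hp
        rw [if_neg fun h => hp (Fin.ext h)]
      · simp
    · by_cases hr : r ∈ Set.range e
      · obtain ⟨s, rfl⟩ := hr
        have hlt : i * k + s.val < δ + k := by omega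
        rw [hlast, rowPad, dif_pos hlt]
        simp only [hposlast s]
        rw [Finset.sum_eq_single ⟨i * k + s.val, hlt⟩]
        · simp
        · intro p _ hp
          rw [if_neg fun h => hp (Fin.ext h)]
        · simp
      · rw [hzero r hr, Finset.sum_eq_zero]
        · rfl
        · rintro p -
          rw [if_neg]
          rintro ⟨rfl, hd⟩
          by_cases hp : p.val < i * k
          · exact (hdlt p hp).ne hd
          · exact hr (by simp [ρ, if_neg hp])
  have hGd : G = delayMat S d ρ := by
    ext1 r c
    rw [hG, delayMat]
    have : ∀ i ∈ Finset.range (μ + 1), Polynomial.C (Gc i r c) * X ^ i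
        = ∑ p, if d p = i then (if ρ p = r then X ^ d p * Polynomial.C (S p c) else 0)
          else 0 := by
      intro i hi
      rw [hGc i (Finset.mem_range_succ_iff.1 hi), map_sum, Finset.sum_mul]
      refine Finset.sum_congr rfl fun p _ => ?_
      by_cases h1 : d p = i <;> by_cases h2 : ρ p = r <;> simp [h1, h2]
    rw [Finset.sum_congr rfl this, Finset.sum_comm]
    refine Finset.sum_congr rfl fun p _ => ?_
    rw [Finset.sum_ite_eq, if_pos (Finset.mem_range_succ_iff.2 (hdle p))]
  have hused : ∀ i < μ, ∀ r, ∃ p, ρ p = r ∧ d p = i := fun i hi r =>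
    ⟨⟨i * k + r.val, (hearly i hi r).trans hμ1⟩, (hpos i hi r _).2 rfl⟩
  have husedlast : ∀ s, ∃ p, ρ p = e s ∧ d p = μ := fun s =>
    ⟨⟨μ * k + s.val, by omega⟩, (hposlast s _).2 rfl⟩
  have hcol := simplex_exists_col_single hN S hS1 hS2
  have hw := hammingNorm_simplex (by omega) hN S hS1 hS2
  obtain ⟨B, hB⟩ := exists_delayMat_mul_eq_one S d ρ hcol (hused 0 hμ0)
  have hlin := linearIndependent_rows_of_mul_eq_one _ B hB
  have hdist := distances_delayMat (ν := δ / k) S d ρ hw (pow_pos Fintype.card_pos _)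
  rw [hGd]
  refine ⟨hlin, isNoncatastrophic_of_mul_eq_one _ B hB, ⟨_, ⟨hlin, rfl⟩, ?_⟩, ?_⟩
  · classical
    let D : Fin k → ℕ := fun r => (μ - 1) + if r ∈ Set.range e then 1 else 0
    have hsum : ∑ r, D r = δ := by
      have : #{r | r ∈ Set.range e} = δ + k - k * μ := by
        rw [← Fintype.card_subtype]
        exact (Set.card_range_of_injective he.injective).trans (Fintype.card_fin _)
      simp only [D]
      rw [Finset.sum_add_distrib, Finset.sum_boole, this, Finset.sum_const, Finset.card_univ,
        Fintype.card_fin, smul_eq_mul, mul_comm k, Nat.cast_id]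
      omega
    have := intDeg_delayMat S d ρ hcol D ?_ ?_
    · rw [this.1, this.2]
      exact ⟨rfl, hsum⟩
    · intro p
      by_cases hp : p.val < μ * k
      · exact (Nat.le_sub_one_of_lt (hdlt p hp)).trans (Nat.le_add_right _ _)
      · have : ρ p ∈ Set.range e := by simp [ρ, if_neg hp]
        simp only [D, if_pos this]
        have := hdle p
        omega
    · intro r
      by_cases hr : r ∈ Set.range e
      · simp only [D, if_pos hr, Nat.sub_add_cancel hμ0]
        obtain ⟨s, rfl⟩ := hr
        exact husedlast s
      · simp only [D, if_neg hr, add_zero]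
        exact hused _ (by omega) r
  · rcases hμ2.lt_or_eq with hlt | heq
    · have hν : δ / k = μ - 1 := by
        refine Nat.div_eq_of_lt_le (by omega) ?_
        rw [Nat.sub_add_cancel hμ0]
        exact hlt
      refine hdist (fun i hi => hused i (by omega)) ?_
      obtain ⟨r, hr⟩ : ∃ r, r ∉ Set.range e := by
        by_contra! h
        have := Fintype.card_le_of_surjective e h
        simp only [Fintype.card_fin] at this
        omega
      refine ⟨r, ?_⟩
      rintro p rfl
      by_cases hp : p.val < μ * k
      · have := hdlt p hp
        omega
      · exact absurd (by simp [ρ, if_neg hp]) hr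
    · have hν : δ / k = μ := by rw [heq, Nat.mul_div_cancel _ hk0]
      refine hdist (fun i hi r => ?_) ⟨⟨0, hk0⟩, fun p _ => hν ▸ hdle p⟩
      rw [hν] at hi
      rcases hi.lt_or_eq with hi | rfl
      · exact hused i hi r
      · have hsurj : Function.Surjective e := by
          refine ((Fintype.bijective_iff_injective_and_card e).2 ⟨he.injective, ?_⟩).2
          simp only [Fintype.card_fin]
          omega
        obtain ⟨s, rfl⟩ := hsurj r
        exact husedlast s
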